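/- arXiv:1804.05484 — 3 statements merged into one kernel-verified Lean document; each statement's English description precedes it below -/
import Mathlib

section
/- Let M be a d×d real matrix and fix a partition vector s = (s_1,…,s_L). Define B* = (b_ij) ∈ ℝ^{L×L} and λ* = (λ_1,…,λ_L) ∈ ℝ^L by: b_ii = 0 if s_i = 1; b_ii = (Σ_{m,n} M^{ii}_{mn} − Σ_m M^{ii}_{mm})/(s_i(s_i−1)) if s_i ≥ 2; b_ij = (Σ_{m,n} M^{ij}_{mn})/(s_i s_j) for i ≠ j; and λ_i = (1/s_i) Σ_m M^{ii}_{mm} − b_ii, where M^{ij} denotes the (i,j)-th block of M under the partition s. Then for every vector λ' ∈ ℝ^L and every matrix B' ∈ ℝ^{L×L}, the squared Frobenius norm satisfies ‖Λ̄* + B̄* − M‖_F² ≤ ‖Λ̄' + B̄' − M‖_F², where Λ̄*, B̄* (resp. Λ̄', B̄') are the diagonal and full expansion matrices of diag(λ*), B* (resp. diag(λ'), B') with partition vector s. That is, (λ*, B*) gives the optimal block mean approximation of M in Frobenius norm. -/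
open Matrix BigOperators

/-- The diagonal expansion matrix of `diag lam` with partition vector `s`:
its `((i,m),(j,n))` entry is `lam i` if `i = j` and `m = n`, and `0` otherwise. -/
def diagExp {L : ℕ} (s : Fin L → ℕ) (lam : Fin L → ℝ) :
    Matrix ((i : Fin L) × Fin (s i)) ((i : Fin L) × Fin (s i)) ℝ :=
  Matrix.diagonal fun p => lam p.1

/-- The full expansion matrix of `B` with partition vector `s`:
its `((i,m),(j,n))` entry is `B i j`. -/
def fullExp {L : ℕ} (s : Fin L → ℕ) (B : Matrix (Fin L) (Fin L) ℝ) :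
    Matrix ((i : Fin L) × Fin (s i)) ((i : Fin L) × Fin (s i)) ℝ :=
  Matrix.of fun p q => B p.1 q.1

/-- The optimal `B*` of the block mean approximation of `M`. -/
noncomputable def bmaB {L : ℕ} (s : Fin L → ℕ)
    (M : Matrix ((i : Fin L) × Fin (s i)) ((i : Fin L) × Fin (s i)) ℝ) :
    Matrix (Fin L) (Fin L) ℝ :=
  Matrix.of fun i j =>
    if i = j then
      if s i = 1 then 0
      else ((∑ m : Fin (s i), ∑ n : Fin (s i), M ⟨i, m⟩ ⟨i, n⟩) -
            ∑ m : Fin (s i), M ⟨i, m⟩ ⟨i, m⟩) / ((s i : ℝ) * ((s i : ℝ) - 1))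
    else (∑ m : Fin (s i), ∑ n : Fin (s j), M ⟨i, m⟩ ⟨j, n⟩) / ((s i : ℝ) * (s j : ℝ))

/-- The optimal `λ*` of the block mean approximation of `M`. -/
noncomputable def bmaLam {L : ℕ} (s : Fin L → ℕ)
    (M : Matrix ((i : Fin L) × Fin (s i)) ((i : Fin L) × Fin (s i)) ℝ) :
    Fin L → ℝ :=
  fun i => (1 / (s i : ℝ)) * (∑ m : Fin (s i), M ⟨i, m⟩ ⟨i, m⟩) - bmaB s M i i

theorem sum_sub_sq_le_of_card_mul_eq_sum {α : Type*} (T : Finset α) (f : α → ℝ) (c c' : ℝ)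
    (hc : (T.card : ℝ) * c = ∑ x ∈ T, f x) :
    ∑ x ∈ T, (c - f x) ^ 2 ≤ ∑ x ∈ T, (c' - f x) ^ 2 := by
  have key : ∑ x ∈ T, (c' - f x) ^ 2 - ∑ x ∈ T, (c - f x) ^ 2 = T.card * (c' - c) ^ 2 := by
    have h : ∀ x, (c' - f x) ^ 2 - (c - f x) ^ 2
        = (c' ^ 2 - c ^ 2) - 2 * (c' - c) * f x := fun x => by ring
    rw [← Finset.sum_sub_distrib, Finset.sum_congr rfl fun x _ => h x, Finset.sum_sub_distrib,
      ← Finset.mul_sum, ← hc, Finset.sum_const, nsmul_eq_mul]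
    ring
  have : 0 ≤ (T.card : ℝ) * (c' - c) ^ 2 := by positivity
  linarith

theorem sum_sum_eq_sum_diag_add_sum_offDiag {α : Type*} [Fintype α] [DecidableEq α]
    (g : α → α → ℝ) :
    ∑ m, ∑ n, g m n =
      ∑ m, g m m + ∑ x ∈ (Finset.univ : Finset α).offDiag, g x.1 x.2 := by
  rw [← Finset.sum_product' Finset.univ Finset.univ g, ← Finset.diag_union_offDiag,
    Finset.sum_union (Finset.disjoint_diag_offDiag _), Finset.sum_diag]

theorem sum_diag_block_sq_le {n : ℕ} (A : Fin n → Fin n → ℝ) (a b a' b' : ℝ)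
    (hdiag : (n : ℝ) * (a + b) = ∑ m, A m m)
    (hoff : ((n : ℝ) * n - n) * b = (∑ m, ∑ k, A m k) - ∑ m, A m m) :
    ∑ m, ∑ k, ((if m = k then a else 0) + b - A m k) ^ 2 ≤
      ∑ m, ∑ k, ((if m = k then a' else 0) + b' - A m k) ^ 2 := by
  have split (u v : ℝ) : ∑ m, ∑ k, ((if m = k then u else 0) + v - A m k) ^ 2 =
      ∑ m, (u + v - A m m) ^ 2 +
        ∑ x ∈ (Finset.univ : Finset (Fin n)).offDiag, (v - A x.1 x.2) ^ 2 := by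
    rw [sum_sum_eq_sum_diag_add_sum_offDiag]
    congr 1
    · simp
    · refine Finset.sum_congr rfl fun x hx => ?_
      rw [if_neg (Finset.mem_offDiag.mp hx).2.2, zero_add]
  rw [split, split]
  refine add_le_add (sum_sub_sq_le_of_card_mul_eq_sum _ _ _ _ (by simpa using hdiag))
    (sum_sub_sq_le_of_card_mul_eq_sum _ (fun x : Fin n × Fin n => A x.1 x.2) _ _ ?_)
  rw [sum_sum_eq_sum_diag_add_sum_offDiag A, add_sub_cancel_left] at hoff
  rw [← hoff, Finset.offDiag_card, Finset.card_univ, Fintype.card_fin,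
    Nat.cast_sub (Nat.le_mul_self n), Nat.cast_mul]

theorem sum_block_sq_le {α β : Type*} [Fintype α] [Fintype β] (A : α → β → ℝ) (b b' : ℝ)
    (hb : (Fintype.card α * Fintype.card β : ℝ) * b = ∑ m, ∑ k, A m k) :
    ∑ m, ∑ k, (b - A m k) ^ 2 ≤ ∑ m, ∑ k, (b' - A m k) ^ 2 := by
  have := sum_sub_sq_le_of_card_mul_eq_sum (Finset.univ : Finset (α × β))
    (fun x => A x.1 x.2) b b' (by simpa [Fintype.sum_prod_type] using hb)
  simpa only [Fintype.sum_prod_type] using this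

theorem sum_sigma_sigma {L : ℕ} (s : Fin L → ℕ)
    (g : ((i : Fin L) × Fin (s i)) → ((i : Fin L) × Fin (s i)) → ℝ) :
    ∑ p, ∑ q, g p q = ∑ i, ∑ j, ∑ m, ∑ n, g ⟨i, m⟩ ⟨j, n⟩ := by
  simp only [Fintype.sum_sigma]
  exact Finset.sum_congr rfl fun i _ => Finset.sum_comm

/-- The block mean approximation `(λ*, B*)` of `M` is optimal in squared Frobenius norm
among all approximations of the form `Λ̄ + B̄`. -/
theorem block_mean_approximation_optimal {L : ℕ} (s : Fin L → ℕ) (hs : ∀ i, 0 < s i)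
    (M : Matrix ((i : Fin L) × Fin (s i)) ((i : Fin L) × Fin (s i)) ℝ)
    (lam' : Fin L → ℝ) (B' : Matrix (Fin L) (Fin L) ℝ) :
    ∑ p, ∑ q, ((diagExp s (bmaLam s M) + fullExp s (bmaB s M) - M) p q) ^ 2 ≤
      ∑ p, ∑ q, ((diagExp s lam' + fullExp s B' - M) p q) ^ 2 := by
  rw [sum_sigma_sigma, sum_sigma_sigma]
  refine Finset.sum_le_sum fun i _ => Finset.sum_le_sum fun j _ => ?_
  have hi : (s i : ℝ) ≠ 0 := Nat.cast_ne_zero.mpr (hs i).ne'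
  have hj : (s j : ℝ) ≠ 0 := Nat.cast_ne_zero.mpr (hs j).ne'
  by_cases hij : i = j
  · subst hij
    have entry (lam : Fin L → ℝ) (B : Matrix (Fin L) (Fin L) ℝ) (m n : Fin (s i)) :
        (diagExp s lam + fullExp s B - M) ⟨i, m⟩ ⟨i, n⟩ =
          (if m = n then lam i else 0) + B i i - M ⟨i, m⟩ ⟨i, n⟩ := by
      simp [diagExp, fullExp, Matrix.diagonal_apply]
    simp only [entry]
    refine sum_diag_block_sq_le (fun m n => M ⟨i, m⟩ ⟨i, n⟩) _ _ _ _ ?_ ?_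
    · rw [bmaLam, sub_add_cancel]
      field_simp
    · by_cases h1 : s i = 1
      · have : Subsingleton (Fin (s i)) := by rw [h1]; infer_instance
        have hsum : ∑ m : Fin (s i), ∑ n : Fin (s i), M ⟨i, m⟩ ⟨i, n⟩ =
            ∑ m : Fin (s i), M ⟨i, m⟩ ⟨i, m⟩ :=
          Finset.sum_congr rfl fun m _ => Fintype.sum_subsingleton _ m
        rw [hsum, sub_self]
        simp [h1]
      · have h1' : (s i : ℝ) - 1 ≠ 0 := sub_ne_zero.mpr (Nat.cast_ne_one.mpr h1)
        simp only [bmaB, Matrix.of_apply, if_true, if_neg h1]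
        field_simp
  · have entry (lam : Fin L → ℝ) (B : Matrix (Fin L) (Fin L) ℝ) (m : Fin (s i))
        (n : Fin (s j)) :
        (diagExp s lam + fullExp s B - M) ⟨i, m⟩ ⟨j, n⟩ = B i j - M ⟨i, m⟩ ⟨j, n⟩ := by
      simp [diagExp, fullExp, hij]
    simp only [entry]
    refine sum_block_sq_le (fun m n => M ⟨i, m⟩ ⟨j, n⟩) _ _ ?_
    simp only [bmaB, Matrix.of_apply, if_neg hij, Fintype.card_fin]
    field_simp
end

section
/- Let s = (s_1,…,s_L) be a partition vector, Λ = diag(λ_1,…,λ_L) with all λ_i ≠ 0, B ∈ ℝ^{L×L}, and S = diag(s_1,…,s_L). Assume the L×L matrix ΛS + SBS is invertible. Let D = (ΛS + SBS)^{−1} − (ΛS)^{−1}. Then the d×d matrix Λ̄ + B̄ is invertible and (Λ̄ + B̄)^{−1} = Λ̄^{−1} + D̄, where Λ̄ is the diagonal expansion matrix of Λ, B̄ is the full expansion matrix of B, and D̄ is the full expansion matrix of D, all with partition vector s. -/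
open Matrix BigOperators

theorem diagExp_mul_diagExp {L : ℕ} (s : Fin L → ℕ) (a b : Fin L → ℝ) :
    diagExp s a * diagExp s b = diagExp s (a * b) := by
  simp [diagExp, Matrix.diagonal_mul_diagonal]

theorem diagExp_one {L : ℕ} (s : Fin L → ℕ) : diagExp s 1 = 1 := by
  simp [diagExp]

theorem diagExp_mul_fullExp {L : ℕ} (s : Fin L → ℕ) (a : Fin L → ℝ)
    (B : Matrix (Fin L) (Fin L) ℝ) :
    diagExp s a * fullExp s B = fullExp s (Matrix.diagonal a * B) := by
  ext p q
  simp [diagExp, fullExp, Matrix.diagonal_mul]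

theorem fullExp_mul_diagExp {L : ℕ} (s : Fin L → ℕ) (a : Fin L → ℝ)
    (B : Matrix (Fin L) (Fin L) ℝ) :
    fullExp s B * diagExp s a = fullExp s (B * Matrix.diagonal a) := by
  ext p q
  simp [diagExp, fullExp, Matrix.mul_diagonal]

theorem fullExp_mul_fullExp {L : ℕ} (s : Fin L → ℕ) (B C : Matrix (Fin L) (Fin L) ℝ) :
    fullExp s B * fullExp s C =
      fullExp s (B * (Matrix.diagonal fun i => (s i : ℝ)) * C) := by
  ext p q
  rw [Matrix.mul_apply, Fintype.sum_sigma, fullExp, fullExp, fullExp, Matrix.of_apply,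
    Matrix.mul_apply]
  refine Finset.sum_congr rfl fun i _ => ?_
  simp only [Matrix.of_apply, Finset.sum_const, Finset.card_univ, Fintype.card_fin,
    nsmul_eq_mul, Matrix.mul_diagonal]
  ring

theorem fullExp_add {L : ℕ} (s : Fin L → ℕ) (B C : Matrix (Fin L) (Fin L) ℝ) :
    fullExp s (B + C) = fullExp s B + fullExp s C := rfl

theorem fullExp_zero {L : ℕ} (s : Fin L → ℕ) : fullExp s 0 = 0 := rfl

theorem diagonal_mul_diagonal_inv {n : Type*} [Fintype n] [DecidableEq n] {a : n → ℝ}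
    (ha : ∀ i, a i ≠ 0) : Matrix.diagonal a * Matrix.diagonal a⁻¹ = 1 := by
  simp [Matrix.diagonal_mul_diagonal, ha]

/-- Theorem 1 of the paper: `(Λ̄ + B̄)⁻¹ = Λ̄⁻¹ + D̄` where
`D = (ΛS + SBS)⁻¹ − (ΛS)⁻¹` and `S = diag(s)`. -/
theorem inv_diagExp_add_fullExp {L : ℕ} (s : Fin L → ℕ) (hs : ∀ i, 0 < s i)
    (lam : Fin L → ℝ) (hlam : ∀ i, lam i ≠ 0)
    (B : Matrix (Fin L) (Fin L) ℝ)
    (S : Matrix (Fin L) (Fin L) ℝ) (hS : S = Matrix.diagonal fun i => (s i : ℝ))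
    (hinv : IsUnit (Matrix.diagonal lam * S + S * B * S)) :
    IsUnit (diagExp s lam + fullExp s B) ∧
      (diagExp s lam + fullExp s B)⁻¹ =
        (diagExp s lam)⁻¹ +
          fullExp s ((Matrix.diagonal lam * S + S * B * S)⁻¹ -
            (Matrix.diagonal lam * S)⁻¹) := by
  have hs' : ∀ i, (s i : ℝ) ≠ 0 := fun i => by exact_mod_cast (hs i).ne'
  have hll : lam * lam⁻¹ = 1 := by
    ext i
    simp [hlam i]
  set Λ := Matrix.diagonal lam with hΛ
  set Λi := Matrix.diagonal lam⁻¹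
  set T := Matrix.diagonal (fun i => (s i : ℝ))⁻¹
  have hΛΛi : Λ * Λi = 1 := diagonal_mul_diagonal_inv hlam
  have hST : S * T = 1 := hS ▸ diagonal_mul_diagonal_inv hs'
  have hTS : T * S = 1 := mul_eq_one_comm.mp hST
  have hcomm : Λ * S = S * Λ := by
    rw [hS, hΛ]
    exact (Matrix.commute_diagonal _ _).eq
  have hΛS : (Λ * S)⁻¹ = T * Λi := by
    apply Matrix.inv_eq_right_inv
    rw [mul_assoc, ← mul_assoc S, hST, one_mul, hΛΛi]
  have hcommT : Λ * T = T * Λ := (Matrix.commute_diagonal _ _).eq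
  set M := Λ * S + S * B * S with hM
  have hfac : Λ + B * S = T * M := by
    rw [hM, hcomm, mul_add, ← mul_assoc, mul_assoc S, ← mul_assoc T S (B * S), hTS,
      one_mul, one_mul]
  have hMinv : (Λ + B * S) * M⁻¹ = T := by
    rw [hfac, mul_assoc, Matrix.mul_nonsing_inv _ ((Matrix.isUnit_iff_isUnit_det _).mp hinv),
      mul_one]
  have hΛSinv : (Λ + B * S) * (Λ * S)⁻¹ = T + B * Λi := by
    rw [hΛS, add_mul, ← mul_assoc Λ, hcommT, mul_assoc T, hΛΛi, mul_one, mul_assoc B,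
      ← mul_assoc S, hST, one_mul]
  set D := M⁻¹ - (Λ * S)⁻¹ with hD
  have hcancel : Λ * D + (B * Λi + B * S * D) = 0 := by
    have h : (Λ + B * S) * D = T - (T + B * Λi) := by rw [hD, mul_sub, hMinv, hΛSinv]
    rw [add_left_comm, ← add_mul, h]
    abel
  have hdiag : diagExp s lam * diagExp s lam⁻¹ = 1 := by
    rw [diagExp_mul_diagExp, hll, diagExp_one]
  have hmul : (diagExp s lam + fullExp s B) * ((diagExp s lam)⁻¹ + fullExp s D) = 1 := by
    rw [Matrix.inv_eq_right_inv hdiag, add_mul, mul_add, mul_add, hdiag, diagExp_mul_fullExp,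
      fullExp_mul_diagExp, fullExp_mul_fullExp, ← hS, add_assoc, ← fullExp_add,
      ← fullExp_add, hcancel, fullExp_zero, add_zero]
  exact ⟨IsUnit.of_mul_eq_one _ hmul, Matrix.inv_eq_right_inv hmul⟩
end

section
/- Let A be an s×s real matrix with s ≥ 2, let I_s be the s×s identity matrix and J_s the s×s all-ones matrix. Set b* = (Σ_{m≠n} A_{mn}) / (s(s−1)) and λ* = (1/s) Σ_m A_{mm} − b*. Then for all real numbers λ and b, ‖λ* I_s + b* J_s − A‖_F² ≤ ‖λ I_s + b J_s − A‖_F², i.e., (λ*, b*) minimizes the Frobenius distance from A among all matrices of the form λ I_s + b J_s. (This is the diagonal-block subproblem in the optimal block mean approximation: the optimal approximation of a diagonal block has off-diagonal entries equal to the mean off-diagonal value of A and diagonal entries equal to the mean diagonal value of A.) -/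
open Matrix BigOperators

/-- The mean off-diagonal value `b* = (Σ_{m≠n} A_{mn}) / (s(s−1))`. -/
noncomputable def bStar (s : ℕ) (A : Matrix (Fin s) (Fin s) ℝ) : ℝ :=
  (∑ m, ∑ n, if m = n then (0 : ℝ) else A m n) / ((s : ℝ) * ((s : ℝ) - 1))

/-- The value `λ* = (1/s) Σ_m A_{mm} − b*`. -/
noncomputable def lamStar (s : ℕ) (A : Matrix (Fin s) (Fin s) ℝ) : ℝ :=
  (1 / (s : ℝ)) * (∑ m, A m m) - bStar s A

/-- The mean of `f` over `t` minimizes the sum of squared deviations. -/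
theorem sum_sq_mean_sub_le {ι : Type*} (t : Finset ι) (f : ι → ℝ) (c : ℝ) :
    ∑ i ∈ t, ((∑ j ∈ t, f j) / t.card - f i) ^ 2 ≤ ∑ i ∈ t, (c - f i) ^ 2 := by
  rcases t.eq_empty_or_nonempty with rfl | ht
  · simp
  have hcard : (0 : ℝ) < t.card := by exact_mod_cast ht.card_pos
  have hexp (a : ℝ) : ∑ i ∈ t, (a - f i) ^ 2 =
      t.card * a ^ 2 - 2 * a * ∑ i ∈ t, f i + ∑ i ∈ t, f i ^ 2 := by
    simp only [sub_sq, Finset.sum_add_distrib, Finset.sum_sub_distrib, Finset.sum_const,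
      nsmul_eq_mul, Finset.mul_sum]
  have hmean : (t.card : ℝ) * ((∑ j ∈ t, f j) / t.card) = ∑ j ∈ t, f j := by
    field_simp
  rw [hexp, hexp]
  generalize (∑ j ∈ t, f j) / (t.card : ℝ) = μ at hmean ⊢
  rw [← hmean]
  nlinarith [mul_nonneg hcard.le (sq_nonneg (c - μ))]

theorem sum_sum_eq_sum_diag_add_sum_offDiag_s10 {ι M : Type*} [Fintype ι] [DecidableEq ι]
    [AddCommMonoid M] (f : ι → ι → M) :
    ∑ m, ∑ n, f m n = ∑ m, f m m + ∑ p ∈ Finset.univ.offDiag, f p.1 p.2 := by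
  rw [← Finset.sum_product', ← Finset.diag_union_offDiag,
    Finset.sum_union (Finset.disjoint_diag_offDiag _), Finset.sum_diag]

/-- The squared Frobenius distance from `A` to `λ I + b J`, split into diagonal and
off-diagonal parts. -/
theorem sum_sq_smul_one_add_smul_ones_sub {ι : Type*} [Fintype ι] [DecidableEq ι]
    (A : Matrix ι ι ℝ) (lam b : ℝ) :
    ∑ m, ∑ n, ((lam • (1 : Matrix ι ι ℝ) + b • (Matrix.of fun _ _ => (1 : ℝ)) - A :
        Matrix ι ι ℝ) m n) ^ 2 =
      ∑ m, (lam + b - A m m) ^ 2 +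
        ∑ p ∈ Finset.univ.offDiag, (b - A p.1 p.2) ^ 2 := by
  rw [sum_sum_eq_sum_diag_add_sum_offDiag_s10]
  congr 1
  · simp
  · refine Finset.sum_congr rfl fun p hp => ?_
    simp [Matrix.one_apply_ne (Finset.mem_offDiag.mp hp).2.2]

theorem bStar_eq_sum_offDiag_div_card {s : ℕ} (A : Matrix (Fin s) (Fin s) ℝ) :
    bStar s A = (∑ p ∈ Finset.univ.offDiag, A p.1 p.2) /
      (Finset.univ : Finset (Fin s)).offDiag.card := by
  rw [bStar, sum_sum_eq_sum_diag_add_sum_offDiag_s10, Finset.offDiag_card, Finset.card_fin,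
    Nat.cast_sub (Nat.le_mul_self s)]
  congr 1
  · simp only [if_true, Finset.sum_const_zero, zero_add]
    exact Finset.sum_congr rfl fun p hp => if_neg (Finset.mem_offDiag.mp hp).2.2
  · push_cast
    ring

theorem lamStar_add_bStar {s : ℕ} (A : Matrix (Fin s) (Fin s) ℝ) :
    lamStar s A + bStar s A = (∑ m, A m m) / (Finset.univ : Finset (Fin s)).card := by
  rw [lamStar, Finset.card_fin]
  ring

/-- `(λ*, b*)` minimizes the squared Frobenius distance from `A` among all matrices of
the form `λ I_s + b J_s` where `J_s` is the all-ones matrix. -/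
theorem diagonal_block_subproblem_optimal {s : ℕ} (hs : 2 ≤ s)
    (A : Matrix (Fin s) (Fin s) ℝ) (lam b : ℝ) :
    ∑ m, ∑ n, (((lamStar s A • (1 : Matrix (Fin s) (Fin s) ℝ) +
        bStar s A • (Matrix.of fun _ _ => (1 : ℝ)) - A :
          Matrix (Fin s) (Fin s) ℝ)) m n) ^ 2 ≤
      ∑ m, ∑ n, (((lam • (1 : Matrix (Fin s) (Fin s) ℝ) +
        b • (Matrix.of fun _ _ => (1 : ℝ)) - A :
          Matrix (Fin s) (Fin s) ℝ)) m n) ^ 2 := by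
  rw [sum_sq_smul_one_add_smul_ones_sub, sum_sq_smul_one_add_smul_ones_sub, lamStar_add_bStar,
    bStar_eq_sum_offDiag_div_card]
  exact add_le_add (sum_sq_mean_sub_le _ (fun m => A m m) _)
    (sum_sq_mean_sub_le _ (fun p : Fin s × Fin s => A p.1 p.2) _)
end
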